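/- For every ρ ∈ ℝ, the second derivative of the tension satisfies τ̂''(ρ) > 0; in particular the tension τ̂ is strictly convex and the isothermal p-system with this tension is genuinely nonlinear. -/

import Mathlib

open MeasureTheory Real

/-- The Gibbs function `G(τ) = log ∫ exp(τ r - V(r)) dr`. -/
noncomputable def gibbsG (V : ℝ → ℝ) (τ : ℝ) : ℝ :=
  Real.log (∫ r : ℝ, Real.exp (τ * r - V r))

/-- The free energy `F(ρ) = sup_τ (τ ρ - G(τ))`. -/
noncomputable def freeF (V : ℝ → ℝ) (ρ : ℝ) : ℝ :=
  ⨆ τ : ℝ, (τ * ρ - gibbsG V τ)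

/-- The tension `τ̂ = F'`. -/
noncomputable def tension (V : ℝ → ℝ) : ℝ → ℝ :=
  deriv (freeF V)

/-- The specific anharmonic potential `V(r) = (1/2)(1-κ)r² + (1/2)κ r max(r,0)`. -/
noncomputable def anharmonicV (κ : ℝ) (r : ℝ) : ℝ :=
  (1 - κ) / 2 * r ^ 2 + κ / 2 * r * max r 0

open Filter Topology ProbabilityTheory

theorem continuous_anharmonicV (κ : ℝ) : Continuous (anharmonicV κ) := by
  unfold anharmonicV
  fun_prop

theorem anharmonicV_le {κ : ℝ} (hκ : 0 ≤ κ) (r : ℝ) : anharmonicV κ r ≤ r ^ 2 / 2 := by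
  unfold anharmonicV
  rcases le_total r 0 with h | h
  · rw [max_eq_right h]
    nlinarith [mul_nonneg hκ (sq_nonneg r)]
  · rw [max_eq_left h]
    nlinarith

theorem le_anharmonicV {κ : ℝ} (hκ : 0 ≤ κ) (r : ℝ) :
    (1 - κ) / 2 * r ^ 2 ≤ anharmonicV κ r := by
  unfold anharmonicV
  rcases le_total r 0 with h | h
  · rw [max_eq_right h]
    simp
  · rw [max_eq_left h]
    nlinarith [mul_nonneg hκ (sq_nonneg r)]

theorem integrable_exp_sub_anharmonicV {κ : ℝ} (hκ0 : 0 ≤ κ) (hκ1 : κ < 1) (τ : ℝ) :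
    Integrable fun r : ℝ => exp (τ * r - anharmonicV κ r) := by
  have ha : 0 < (1 - κ) / 2 := by linarith
  have hint := ((integrable_exp_neg_mul_sq ha).comp_sub_right (τ / (1 - κ))).const_mul
    (exp (τ ^ 2 / (2 * (1 - κ))))
  refine hint.mono' ?_ (.of_forall fun r => ?_)
  · have := continuous_anharmonicV κ
    exact (by fun_prop : Continuous fun r : ℝ => exp (τ * r - anharmonicV κ r)).aestronglyMeasurable
  · rw [norm_of_nonneg (exp_pos _).le, ← exp_add]
    refine exp_le_exp.2 ?_
    have h := le_anharmonicV hκ0 r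
    have hne : 1 - κ ≠ 0 := by linarith
    have : τ ^ 2 / (2 * (1 - κ)) + -((1 - κ) / 2) * (r - τ / (1 - κ)) ^ 2
        = τ * r - (1 - κ) / 2 * r ^ 2 := by
      field_simp
      ring
    linarith

/-- The moments `∫ rᵏ exp(τ r - V(r)) dr` of the unnormalised Gibbs measure. -/
noncomputable def gibbsMoment (V : ℝ → ℝ) (k : ℕ) (τ : ℝ) : ℝ :=
  ∫ r : ℝ, r ^ k * exp (τ * r - V r)

section Moments

variable {V : ℝ → ℝ}

theorem mem_interior_integrableExpSet_withDensity (hV : Measurable V)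
    (hint : ∀ τ, Integrable fun r : ℝ => exp (τ * r - V r)) (τ : ℝ) :
    τ ∈ interior (integrableExpSet id
      (volume.withDensity fun r => ((exp (-V r)).toNNReal : ENNReal))) := by
  have : integrableExpSet id
      (volume.withDensity fun r => ((exp (-V r)).toNNReal : ENNReal)) = Set.univ := by
    refine Set.eq_univ_of_forall fun t => ?_
    have hm : Measurable fun r => (exp (-V r)).toNNReal := by fun_prop
    rw [integrableExpSet, Set.mem_ofPred_eq, integrable_withDensity_iff_integrable_smul hm]
    refine (hint t).congr (.of_forall fun r => ?_)
    simp [NNReal.smul_def, exp_nonneg, ← exp_add]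
    ring
  simp [this]

theorem integrable_pow_mul_exp_sub (hV : Measurable V)
    (hint : ∀ τ, Integrable fun r : ℝ => exp (τ * r - V r)) (k : ℕ) (τ : ℝ) :
    Integrable fun r : ℝ => r ^ k * exp (τ * r - V r) := by
  have hm : Measurable fun r => (exp (-V r)).toNNReal := by fun_prop
  have h := integrable_pow_mul_exp_of_mem_interior_integrableExpSet
    (mem_interior_integrableExpSet_withDensity hV hint τ) k
  rw [integrable_withDensity_iff_integrable_smul hm] at h
  refine h.congr (.of_forall fun r => ?_)
  simp only [NNReal.smul_def, coe_toNNReal _ (exp_nonneg _), id, smul_eq_mul, sub_eq_add_neg,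
    exp_add]
  ring

theorem hasDerivAt_gibbsMoment (hV : Measurable V)
    (hint : ∀ τ, Integrable fun r : ℝ => exp (τ * r - V r)) (k : ℕ) (τ : ℝ) :
    HasDerivAt (gibbsMoment V k) (gibbsMoment V (k + 1) τ) τ := by
  have hm : Measurable fun r => (exp (-V r)).toNNReal := by fun_prop
  have key (j : ℕ) (t : ℝ) : gibbsMoment V j t = ∫ r, (id r) ^ j * exp (t * id r)
      ∂(volume.withDensity fun r => ((exp (-V r)).toNNReal : ENNReal)) := by
    rw [integral_withDensity_eq_integral_smul hm, gibbsMoment]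
    refine integral_congr_ae (.of_forall fun r => ?_)
    simp only [NNReal.smul_def, coe_toNNReal _ (exp_nonneg _), id, smul_eq_mul, sub_eq_add_neg,
      exp_add]
    ring
  rw [key, funext (key k)]
  exact hasDerivAt_integral_pow_mul_exp_real
    (mem_interior_integrableExpSet_withDensity hV hint τ) k

theorem gibbsMoment_zero_pos (hint : ∀ τ, Integrable fun r : ℝ => exp (τ * r - V r)) (τ : ℝ) :
    0 < gibbsMoment V 0 τ := by
  simpa [gibbsMoment] using integral_exp_pos (hint τ)

theorem gibbsG_eq_log_gibbsMoment (τ : ℝ) : gibbsG V τ = log (gibbsMoment V 0 τ) := by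
  simp [gibbsG, gibbsMoment]

theorem integral_sub_sq_mul_exp (hV : Measurable V)
    (hint : ∀ τ, Integrable fun r : ℝ => exp (τ * r - V r)) (m τ : ℝ) :
    ∫ r : ℝ, (r - m) ^ 2 * exp (τ * r - V r) =
      gibbsMoment V 2 τ - 2 * m * gibbsMoment V 1 τ + m ^ 2 * gibbsMoment V 0 τ := by
  have h k := integrable_pow_mul_exp_sub hV hint k τ
  have h21 : Integrable fun r : ℝ =>
      r ^ 2 * exp (τ * r - V r) - 2 * m * (r ^ 1 * exp (τ * r - V r)) :=
    (h 2).sub ((h 1).const_mul _)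
  simp only [gibbsMoment]
  rw [← integral_const_mul, ← integral_const_mul, ← integral_sub (h 2) ((h 1).const_mul _),
    ← integral_add h21 ((h 0).const_mul _)]
  refine integral_congr_ae (.of_forall fun r => ?_)
  ring

theorem integral_sub_pow_three_mul_exp (hV : Measurable V)
    (hint : ∀ τ, Integrable fun r : ℝ => exp (τ * r - V r)) (m τ : ℝ) :
    ∫ r : ℝ, (r - m) ^ 3 * exp (τ * r - V r) =
      gibbsMoment V 3 τ - 3 * m * gibbsMoment V 2 τ + 3 * m ^ 2 * gibbsMoment V 1 τ
        - m ^ 3 * gibbsMoment V 0 τ := by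
  have h k := integrable_pow_mul_exp_sub hV hint k τ
  have h32 : Integrable fun r : ℝ =>
      r ^ 3 * exp (τ * r - V r) - 3 * m * (r ^ 2 * exp (τ * r - V r)) :=
    (h 3).sub ((h 2).const_mul _)
  have h321 : Integrable fun r : ℝ =>
      r ^ 3 * exp (τ * r - V r) - 3 * m * (r ^ 2 * exp (τ * r - V r))
        + 3 * m ^ 2 * (r ^ 1 * exp (τ * r - V r)) :=
    h32.add ((h 1).const_mul _)
  simp only [gibbsMoment]
  rw [← integral_const_mul, ← integral_const_mul, ← integral_const_mul,
    ← integral_sub (h 3) ((h 2).const_mul _),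
    ← integral_add h32 ((h 1).const_mul _), ← integral_sub h321 ((h 0).const_mul _)]
  refine integral_congr_ae (.of_forall fun r => ?_)
  ring

theorem integrable_sub_pow_mul_exp (hV : Measurable V)
    (hint : ∀ τ, Integrable fun r : ℝ => exp (τ * r - V r)) (k : ℕ) (m τ : ℝ) :
    Integrable fun r : ℝ => (r - m) ^ k * exp (τ * r - V r) := by
  simp only [sub_eq_add_neg _ m, add_pow, Finset.sum_mul]
  refine integrable_finsetSum _ fun i _ => ?_
  refine ((integrable_pow_mul_exp_sub hV hint i τ).const_mul
    ((-m) ^ (k - i) * (k.choose i : ℝ))).congr (.of_forall fun r => ?_)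
  simp only
  ring

theorem integral_sub_sq_mul_exp_pos (hV : Continuous V)
    (hint : ∀ τ, Integrable fun r : ℝ => exp (τ * r - V r)) (m τ : ℝ) :
    0 < ∫ r : ℝ, (r - m) ^ 2 * exp (τ * r - V r) := by
  refine integral_pos_of_integrable_nonneg_nonzero (x := m + 1) (by fun_prop)
    (integrable_sub_pow_mul_exp hV.measurable hint 2 m τ) (fun r => by positivity) ?_
  simp [(exp_pos _).ne']

theorem hasDerivAt_gibbsG (hV : Measurable V)
    (hint : ∀ τ, Integrable fun r : ℝ => exp (τ * r - V r)) (τ : ℝ) :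
    HasDerivAt (gibbsG V) (gibbsMoment V 1 τ / gibbsMoment V 0 τ) τ := by
  rw [funext (gibbsG_eq_log_gibbsMoment (V := V))]
  exact (hasDerivAt_gibbsMoment hV hint 0 τ).log (gibbsMoment_zero_pos hint τ).ne'

/-- The derivative of the mean of a Gibbs measure is its variance. -/
theorem hasDerivAt_gibbs_mean (hV : Measurable V)
    (hint : ∀ τ, Integrable fun r : ℝ => exp (τ * r - V r)) (τ : ℝ) :
    HasDerivAt (fun t => gibbsMoment V 1 t / gibbsMoment V 0 t)
      (gibbsMoment V 2 τ / gibbsMoment V 0 τ - (gibbsMoment V 1 τ / gibbsMoment V 0 τ) ^ 2) τ := by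
  have h0 := (gibbsMoment_zero_pos hint τ).ne'
  refine ((hasDerivAt_gibbsMoment hV hint 1 τ).fun_div
    (hasDerivAt_gibbsMoment hV hint 0 τ) h0).congr_deriv ?_
  field_simp

theorem gibbs_variance_pos (hV : Continuous V)
    (hint : ∀ τ, Integrable fun r : ℝ => exp (τ * r - V r)) (τ : ℝ) :
    0 < gibbsMoment V 2 τ / gibbsMoment V 0 τ - (gibbsMoment V 1 τ / gibbsMoment V 0 τ) ^ 2 := by
  have h0 := gibbsMoment_zero_pos hint τ
  have h := integral_sub_sq_mul_exp_pos hV hint (gibbsMoment V 1 τ / gibbsMoment V 0 τ) τ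
  rw [integral_sub_sq_mul_exp hV.measurable hint] at h
  refine (div_pos h h0).trans_eq ?_
  field_simp
  ring

/-- The derivative of the variance of a Gibbs measure is its third central moment. -/
theorem hasDerivAt_gibbs_variance (hV : Measurable V)
    (hint : ∀ τ, Integrable fun r : ℝ => exp (τ * r - V r)) (τ : ℝ) :
    HasDerivAt
      (fun t => gibbsMoment V 2 t / gibbsMoment V 0 t - (gibbsMoment V 1 t / gibbsMoment V 0 t) ^ 2)
      ((∫ r : ℝ, (r - gibbsMoment V 1 τ / gibbsMoment V 0 τ) ^ 3 * exp (τ * r - V r))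
        / gibbsMoment V 0 τ) τ := by
  have h0 := (gibbsMoment_zero_pos hint τ).ne'
  refine (((hasDerivAt_gibbsMoment hV hint 2 τ).fun_div (hasDerivAt_gibbsMoment hV hint 0 τ)
    h0).fun_sub ((hasDerivAt_gibbs_mean hV hint τ).fun_pow 2)).congr_deriv ?_
  rw [integral_sub_pow_three_mul_exp hV hint]
  field_simp
  simp only [Nat.cast_ofNat, Nat.add_one_sub_one, pow_one, zero_add, Nat.reduceAdd]
  field_simp
  ring

end Moments

/-- A centred weight whose reflected difference `q x - q (-x)` changes sign once, from positive to
negative, on the positive half-line has a negative third moment. -/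
theorem integral_pow_three_mul_neg_of_sign_change {q : ℝ → ℝ} (hq : Continuous q)
    (h1 : Integrable fun x => x * q x) (h3 : Integrable fun x => x ^ 3 * q x)
    (hmean : ∫ x, x * q x = 0) {c : ℝ} (hc : 0 ≤ c)
    (hlt : ∀ x, 0 ≤ x → x < c → q (-x) ≤ q x) (hgt : ∀ x, c < x → q x < q (-x)) :
    ∫ x, x ^ 3 * q x < 0 := by
  have h1' : Integrable fun x => x * q (-x) := by
    simpa using h1.comp_neg.neg
  have h3' : Integrable fun x => x ^ 3 * q (-x) := by
    refine h3.comp_neg.neg.congr (.of_forall fun x => ?_)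
    simp only [Pi.neg_apply]
    ring
  have e1 : ∫ x, x * q (-x) = 0 := by
    have := integral_neg_eq_self (fun x => x * q x) volume
    simp only [neg_mul, integral_neg, hmean] at this
    linarith
  have e3 : ∫ x, x ^ 3 * q (-x) = -∫ x, x ^ 3 * q x := by
    rw [← integral_neg_eq_self (fun x => x ^ 3 * q x) volume, ← integral_neg]
    exact integral_congr_ae (.of_forall fun x => by simp only; ring)
  have h1d : Integrable fun x => x * q (-x) - x * q x := h1'.sub h1
  have h3d : Integrable fun x => x ^ 3 * q (-x) - x ^ 3 * q x := h3'.sub h3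
  let f : ℝ → ℝ := fun x => x * (x ^ 2 - c ^ 2) * (q (-x) - q x)
  have hf : f = fun x => (x ^ 3 * q (-x) - x ^ 3 * q x) - c ^ 2 * (x * q (-x) - x * q x) := by
    ext x
    simp only [f]
    ring
  have hfi : Integrable f := hf ▸ h3d.sub (h1d.const_mul _)
  have hpos_half (x : ℝ) (hx : 0 ≤ x) : 0 ≤ f x := by
    rcases lt_trichotomy x c with h | h | h
    · have := hlt x hx h
      have h2 : x ^ 2 - c ^ 2 ≤ 0 := by nlinarith
      exact mul_nonneg_of_nonpos_of_nonpos (mul_nonpos_of_nonneg_of_nonpos hx h2) (by linarith)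
    · simp [f, h]
    · have := hgt x h
      have h2 : 0 ≤ x ^ 2 - c ^ 2 := by nlinarith
      exact mul_nonneg (mul_nonneg hx h2) (by linarith)
  have hnonneg : 0 ≤ f := fun x => by
    rcases le_total 0 x with hx | hx
    · exact hpos_half x hx
    · have h := hpos_half (-x) (by linarith)
      have : f (-x) = f x := by simp only [f, neg_neg]; ring
      simpa [this] using h
  have hpos : 0 < ∫ x, f x := by
    refine integral_pos_of_integrable_nonneg_nonzero (x := c + 1) (by fun_prop) hfi hnonneg ?_
    have := hgt (c + 1) (by linarith)
    have h2 : 0 < (c + 1) ^ 2 - c ^ 2 := by nlinarith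
    exact (mul_pos (mul_pos (by linarith) h2) (by linarith)).ne'
  have hI : ∫ x, f x = -2 * ∫ x, x ^ 3 * q x := by
    rw [hf, integral_sub h3d (h1d.const_mul _), integral_sub h3' h3,
      integral_const_mul, integral_sub h1' h1, e1, e3, hmean]
    ring
  linarith

/-- Difference of the anharmonic potential at points reflected about `m`, up to its linear part. -/
theorem anharmonicV_sub_reflect (κ m x : ℝ) :
    anharmonicV κ (m - x) - anharmonicV κ (m + x) =
      -2 * m * x - κ / 2 * ((min (m - x) 0) ^ 2 - (min (m + x) 0) ^ 2) := by
  unfold anharmonicV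
  rcases le_total (m - x) 0 with h | h <;> rcases le_total (m + x) 0 with h' | h' <;>
    simp only [min_eq_left, min_eq_right, max_eq_left, max_eq_right, h, h'] <;> ring

theorem min_sq_sub_min_sq_mul_le {m x y : ℝ} (hx : 0 ≤ x) (hxy : x ≤ y) :
    y * ((min (m - x) 0) ^ 2 - (min (m + x) 0) ^ 2) ≤
      x * ((min (m - y) 0) ^ 2 - (min (m + y) 0) ^ 2) := by
  rcases hxy.eq_or_lt with rfl | hlt
  · rfl
  have hsq : m - x ≤ 0 → 0 ≤ m + x → 0 ≤ (y - x) * (x * y - m ^ 2) := fun h h' =>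
    mul_nonneg (sub_nonneg.2 hxy) (by nlinarith [mul_nonneg hx (sub_nonneg.2 hxy)])
  rcases le_total (m - x) 0 with h1 | h1 <;> rcases le_total (m + x) 0 with h2 | h2 <;>
  rcases le_total (m - y) 0 with h3 | h3 <;> rcases le_total (m + y) 0 with h4 | h4 <;>
    simp only [min_eq_left, min_eq_right, h1, h2, h3, h4] <;>
    first
    | linarith
    | nlinarith [mul_nonneg hx (sq_nonneg (m + y)), mul_nonneg hx (sq_nonneg (m - y))]
    | nlinarith [hsq h1 h2]

/-- The Gibbs measures of the anharmonic potential have negative third central moment. -/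
theorem integral_sub_mean_pow_three_neg {κ : ℝ} (hκ0 : 0 < κ) (hκ1 : κ < 1) (τ m : ℝ)
    (hm : m = gibbsMoment (anharmonicV κ) 1 τ / gibbsMoment (anharmonicV κ) 0 τ) :
    ∫ r : ℝ, (r - m) ^ 3 * exp (τ * r - anharmonicV κ r) < 0 := by
  have hV := continuous_anharmonicV κ
  have hint := integrable_exp_sub_anharmonicV hκ0.le hκ1
  let E : ℝ → ℝ := fun x => (min (m - x) 0) ^ 2 - (min (m + x) 0) ^ 2
  let D : ℝ → ℝ := fun x => 2 * (τ - m) * x - κ / 2 * E x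
  have hD (x : ℝ) : (τ * (m + x) - anharmonicV κ (m + x)) -
      (τ * (m - x) - anharmonicV κ (m - x)) = D x := by
    have := anharmonicV_sub_reflect κ m x
    simp only [D, E]
    linarith
  have hDmono {x y : ℝ} (hx : 0 ≤ x) (hxy : x ≤ y) (hy : 0 ≤ D y) : 0 ≤ D x := by
    rcases hx.eq_or_lt with rfl | hx0
    · simp [D, E]
    · have h1 : x * D y ≤ y * D x := by
        have := min_sq_sub_min_sq_mul_le (m := m) hx hxy
        simp only [D, E]
        nlinarith
      have h2 : 0 ≤ y * D x := (mul_nonneg hx hy).trans h1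
      exact nonneg_of_mul_nonneg_right h2 (hx0.trans_le hxy)
  let S : Set ℝ := {x | 0 ≤ x ∧ 0 ≤ D x}
  have hS0 : (0 : ℝ) ∈ S := by simp [S, D, E]
  have hSb : BddAbove S := by
    refine ⟨2 * |m| + 16 * |τ - m| / κ, fun x hx => ?_⟩
    by_contra! h
    have hx1 : 2 * |m| < x := by
      have : 0 ≤ 16 * |τ - m| / κ := by positivity
      linarith
    have hx2 : 16 * |τ - m| < x * κ := by
      rw [← div_lt_iff₀ hκ0]
      linarith [abs_nonneg m]
    have hx0 : 0 < x := by linarith [abs_nonneg m]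
    have hDx := hx.2
    simp only [D, E] at hDx
    rw [min_eq_left (by linarith [le_abs_self m]), min_eq_right (by linarith [neg_abs_le m])]
      at hDx
    have hsq : x ^ 2 / 4 ≤ (m - x) ^ 2 := by nlinarith [le_abs_self m]
    have hlin : (τ - m) * x ≤ |τ - m| * x := mul_le_mul_of_nonneg_right (le_abs_self _) hx0.le
    nlinarith [mul_le_mul_of_nonneg_left hsq hκ0.le, mul_lt_mul_of_pos_right hx2 hx0]
  have hc : 0 ≤ sSup S := le_csSup hSb hS0
  have hcomp (f : ℝ → ℝ) : ∫ r, f (m + r) = ∫ r, f r := integral_add_left_eq_self f m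
  have key := integral_pow_three_mul_neg_of_sign_change
    (q := fun x => exp (τ * (m + x) - anharmonicV κ (m + x))) (by fun_prop) ?_ ?_ ?_ hc ?_ ?_
  · rw [← hcomp]
    simpa using key
  · simpa using (integrable_sub_pow_mul_exp hV.measurable hint 1 m τ).comp_add_left m
  · simpa using (integrable_sub_pow_mul_exp hV.measurable hint 3 m τ).comp_add_left m
  · have h := hcomp fun r => (r - m) * exp (τ * r - anharmonicV κ r)
    simp only [add_sub_cancel_left] at h
    have h0 := (gibbsMoment_zero_pos hint τ).ne'
    have i0 := integrable_pow_mul_exp_sub hV.measurable hint 0 τ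
    have i1 := integrable_pow_mul_exp_sub hV.measurable hint 1 τ
    rw [h]
    have : (fun r => (r - m) * exp (τ * r - anharmonicV κ r)) = fun r =>
        r ^ 1 * exp (τ * r - anharmonicV κ r) - m * (r ^ 0 * exp (τ * r - anharmonicV κ r)) := by
      ext r
      ring
    rw [this, integral_sub i1 (i0.const_mul _), integral_const_mul]
    change gibbsMoment (anharmonicV κ) 1 τ - m * gibbsMoment (anharmonicV κ) 0 τ = 0
    rw [hm]
    field_simp
    ring
  · intro x hx hxc
    obtain ⟨y, hy, hxy⟩ := exists_lt_of_lt_csSup ⟨0, hS0⟩ hxc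
    have := hDmono hx hxy.le hy.2
    rw [exp_le_exp, ← sub_eq_add_neg]
    linarith [hD x]
  · intro x hxc
    have : D x < 0 := by
      by_contra! h
      exact hxc.not_ge (le_csSup hSb ⟨hc.trans hxc.le, h⟩)
    rw [exp_lt_exp, ← sub_eq_add_neg]
    linarith [hD x]

theorem sq_div_two_le_gibbsG_anharmonicV {κ : ℝ} (hκ0 : 0 ≤ κ) (hκ1 : κ < 1) (τ : ℝ) :
    τ ^ 2 / 2 ≤ gibbsG (anharmonicV κ) τ := by
  have hint := integrable_exp_sub_anharmonicV hκ0 hκ1 τ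
  rw [gibbsG, le_log_iff_exp_le (integral_exp_pos hint)]
  have hg : Integrable fun r : ℝ => exp (τ ^ 2 / 2) * exp (-(1 / 2) * (r - τ) ^ 2) :=
    ((integrable_exp_neg_mul_sq (by norm_num : (0 : ℝ) < 1 / 2)).comp_sub_right τ).const_mul _
  have hI : ∫ r : ℝ, exp (τ ^ 2 / 2) * exp (-(1 / 2) * (r - τ) ^ 2) =
      exp (τ ^ 2 / 2) * √(π / (1 / 2)) := by
    rw [integral_const_mul, integral_sub_right_eq_self (fun r : ℝ => exp (-(1 / 2) * r ^ 2)) τ,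
      integral_gaussian]
  calc exp (τ ^ 2 / 2) ≤ exp (τ ^ 2 / 2) * √(π / (1 / 2)) :=
        le_mul_of_one_le_right (exp_pos _).le
          (one_le_sqrt.2 (by linarith [pi_gt_three, div_eq_mul_inv π (1 / 2)]))
    _ = _ := hI.symm
    _ ≤ _ := by
      refine integral_mono hg hint fun r => ?_
      simp only [← exp_add]
      refine exp_le_exp.2 ?_
      linarith [anharmonicV_le hκ0 r]

/-- The Legendre transform of a superlinear function `G` with positive second
derivative is differentiable, and its derivative `T` inverts the derivative of `G`. -/
theorem exists_hasDerivAt_legendre {G g₁ g₂ g₃ : ℝ → ℝ} (h₁ : ∀ t, HasDerivAt G (g₁ t) t)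
    (h₂ : ∀ t, HasDerivAt g₁ (g₂ t) t) (h₃ : ∀ t, HasDerivAt g₂ (g₃ t) t) (hg₂ : ∀ t, 0 < g₂ t)
    (hG : ∀ ρ, Tendsto (fun t => G t - t * ρ) (cocompact ℝ) atTop) :
    ∃ T : ℝ → ℝ, (∀ ρ, HasDerivAt (fun ρ => ⨆ t, (t * ρ - G t)) (T ρ) ρ) ∧
      (∀ ρ, HasDerivAt T (g₂ (T ρ))⁻¹ ρ) ∧
      ∀ ρ, HasDerivAt (fun ρ => (g₂ (T ρ))⁻¹) (-g₃ (T ρ) / g₂ (T ρ) ^ 3) ρ := by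
  have hcont : Continuous G := continuous_iff_continuousAt.2 fun t => (h₁ t).continuousAt
  have hex (ρ : ℝ) : ∃ s, ∀ t, G s - s * ρ ≤ G t - t * ρ :=
    (by fun_prop : Continuous fun t => G t - t * ρ).exists_forall_le (hG ρ)
  choose T hT using hex
  have hmono : StrictMono g₁ := strictMono_of_hasDerivAt_pos h₂ hg₂
  have hinv (ρ : ℝ) : g₁ (T ρ) = ρ := by
    have hd : HasDerivAt (fun t => G t - t * ρ) (g₁ (T ρ) - 1 * ρ) (T ρ) :=
      (h₁ _).sub ((hasDerivAt_id _).mul_const ρ)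
    have := IsLocalMin.hasDerivAt_eq_zero (.of_forall (hT ρ)) hd
    linarith
  have hTcont : Continuous T := by
    have hsurj : Function.Surjective g₁ := fun ρ => ⟨T ρ, hinv ρ⟩
    have : T = (hmono.orderIsoOfSurjective _ hsurj).symm := by
      ext ρ
      apply hmono.injective
      exact (hinv ρ).trans (hmono.orderIsoOfSurjective_self_symm_apply _ hsurj ρ).symm
    rw [this]
    exact OrderIso.continuous _
  have hTd (ρ : ℝ) : HasDerivAt T (g₂ (T ρ))⁻¹ ρ :=
    .of_local_left_inverse hTcont.continuousAt (h₂ _) (hg₂ _).ne' (.of_forall hinv)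
  refine ⟨T, fun ρ => ?_, hTd, fun ρ => ?_⟩
  · have hF : (fun ρ => ⨆ t, (t * ρ - G t)) = fun ρ => T ρ * ρ - G (T ρ) := by
      ext ρ
      refine le_antisymm (ciSup_le fun t => by linarith [hT ρ t])
        (le_ciSup (f := fun t => t * ρ - G t) ⟨T ρ * ρ - G (T ρ), ?_⟩ (T ρ))
      rintro _ ⟨t, rfl⟩
      linarith [hT ρ t]
    rw [hF]
    refine (((hTd ρ).fun_mul (hasDerivAt_id ρ)).fun_sub
      ((h₁ (T ρ)).comp ρ (hTd ρ))).congr_deriv ?_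
    rw [hinv]
    simp only [id]
    ring
  · have hne := (hg₂ (T ρ)).ne'
    refine (((h₃ (T ρ)).comp ρ (hTd ρ)).fun_inv hne).congr_deriv ?_
    simp only [Function.comp]
    field_simp

/-- for the potential `V(r) = (1/2)(1-κ)r² + (1/2)κ r |r|₊` with
`0 < κ < 1/3`, the tension satisfies `τ̂''(ρ) > 0` for every `ρ`; in particular `τ̂`
is strictly convex (genuine nonlinearity of the p-system). -/
theorem tension_strictly_convex_for_anharmonicV
    (κ : ℝ) (hκ0 : 0 < κ) (hκ1 : κ < 1/3) :
    (∀ ρ : ℝ, 0 < iteratedDeriv 2 (tension (anharmonicV κ)) ρ) ∧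
    StrictConvexOn ℝ Set.univ (tension (anharmonicV κ)) := by
  have hκ : κ < 1 := by linarith
  have hV := continuous_anharmonicV κ
  have hint := integrable_exp_sub_anharmonicV hκ0.le hκ
  have hcoer (ρ : ℝ) :
      Tendsto (fun t => gibbsG (anharmonicV κ) t - t * ρ) (cocompact ℝ) atTop := by
    refine tendsto_atTop_mono (f := fun t => |t| - (|ρ| + 1) ^ 2 / 2) (fun t => ?_)
      (tendsto_atTop_add_const_right _ _ tendsto_norm_cocompact_atTop)
    have h := sq_div_two_le_gibbsG_anharmonicV hκ0.le hκ t
    have h' : t * ρ ≤ |t| * |ρ| := (le_abs_self _).trans (abs_mul t ρ).le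
    nlinarith [sq_nonneg (|t| - (|ρ| + 1)), sq_abs t]
  obtain ⟨T, hF, hT, hT'⟩ := exists_hasDerivAt_legendre (hasDerivAt_gibbsG hV.measurable hint)
    (hasDerivAt_gibbs_mean hV.measurable hint) (hasDerivAt_gibbs_variance hV.measurable hint)
    (gibbs_variance_pos hV hint) hcoer
  have htension : tension (anharmonicV κ) = T := funext fun ρ => (hF ρ).deriv
  have hd2 (ρ : ℝ) : 0 < deriv^[2] T ρ := by
    rw [Function.iterate_succ, Function.iterate_one, Function.comp,
      funext fun ρ => (hT ρ).deriv, (hT' ρ).deriv]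
    exact div_pos (neg_pos.2 (div_neg_of_neg_of_pos
      (integral_sub_mean_pow_three_neg hκ0 hκ _ _ rfl) (gibbsMoment_zero_pos hint _)))
      (pow_pos (gibbs_variance_pos hV hint _) 3)
  rw [htension]
  refine ⟨fun ρ => ?_, strictConvexOn_of_deriv2_pos' convex_univ
    (fun ρ _ => (hT ρ).continuousAt.continuousWithinAt) fun ρ _ => hd2 ρ⟩
  rw [iteratedDeriv_eq_iterate]
  exact hd2 ρ
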